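/- arXiv:2005.00893 — 7 statements merged into one kernel-verified Lean document; each statement's English description precedes it below -/
import Mathlib

section
/- Let k ≥ 2, a ≥ 1, r ≥ 1 be integers, let n : Fin r → ℕ satisfy n_i ≥ 1 for all i, and let m : Fin r → ℕ be strictly increasing with m_i ≥ 1 for all i. Assume ∑_i n_i = k² + 3 and ∑_i n_i·m_i² = a². If δ := ∑_{i<j} n_i·n_j·(m_j − m_i)² − ∑_i n_i·m_i² ≥ 0, then (∑_i n_i·m_i)/a < k + 1/k (as real numbers). -/
/-- A symmetric double sum vanishing on the diagonal is twice its strictly upper part. -/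
theorem Finset.sum_sum_eq_two_mul_sum_sum_lt {ι R : Type*} [Fintype ι] [LinearOrder ι]
    [CommRing R] (f : ι → ι → R) (hsymm : ∀ i j, f i j = f j i) (hdiag : ∀ i, f i i = 0) :
    ∑ i, ∑ j, f i j = 2 * ∑ i, ∑ j ∈ Finset.univ.filter (fun j => i < j), f i j := by
  have hsplit : ∀ i j, f i j = (if i < j then f i j else 0) + (if j < i then f j i else 0) := by
    intro i j
    rcases lt_trichotomy i j with h | rfl | h
    · simp [h, h.not_gt]
    · simp [hdiag]
    · simp [h, h.not_gt, hsymm i j]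
  have hswap : ∑ i, ∑ j, (if j < i then f j i else 0) =
      ∑ i, ∑ j, (if i < j then f i j else 0) := Finset.sum_comm
  calc ∑ i, ∑ j, f i j
      = ∑ i, ∑ j, ((if i < j then f i j else 0) + (if j < i then f j i else 0)) :=
        Finset.sum_congr rfl fun i _ => Finset.sum_congr rfl fun j _ => hsplit i j
    _ = 2 * ∑ i, ∑ j ∈ Finset.univ.filter (fun j => i < j), f i j := by
        simp only [Finset.sum_add_distrib, hswap, Finset.sum_filter]
        ring

/-- Lagrange's identity for the weights `w` and the values `x`. -/
theorem Finset.sum_sum_lt_weighted_sub_sq {ι : Type*} [Fintype ι] [LinearOrder ι]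
    (w x : ι → ℤ) :
    ∑ i, ∑ j ∈ Finset.univ.filter (fun j => i < j), w i * w j * (x j - x i) ^ 2 =
      (∑ i, w i) * (∑ i, w i * x i ^ 2) - (∑ i, w i * x i) ^ 2 := by
  have hdouble := Finset.sum_sum_eq_two_mul_sum_sum_lt
    (fun i j => w i * w j * (x j - x i) ^ 2) (fun i j => by ring) (fun i => by ring)
  have hexpand : ∑ i, ∑ j, w i * w j * (x j - x i) ^ 2 =
      (∑ i, w i) * (∑ j, w j * x j ^ 2) + (∑ i, w i * x i ^ 2) * (∑ j, w j)
        - 2 * ((∑ i, w i * x i) * (∑ j, w j * x j)) := by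
    simp only [Finset.sum_mul_sum]
    simp only [Finset.mul_sum, ← Finset.sum_add_distrib, ← Finset.sum_sub_distrib]
    exact Finset.sum_congr rfl fun i _ => Finset.sum_congr rfl fun j _ => by ring
  linarith

theorem sigma_lt_of_delta_nonneg (k a r : ℕ) (hk : 2 ≤ k) (ha : 1 ≤ a) (hr : 1 ≤ r)
    (n : Fin r → ℕ) (hn : ∀ i, 1 ≤ n i)
    (m : Fin r → ℕ) (hm : StrictMono m) (hm1 : ∀ i, 1 ≤ m i)
    (hcount : ∑ i, n i = k ^ 2 + 3)
    (harea : ∑ i, n i * m i ^ 2 = a ^ 2)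
    (hdelta : 0 ≤ (∑ i, ∑ j ∈ Finset.univ.filter (fun j => i < j),
        (n i : ℤ) * n j * ((m j : ℤ) - m i) ^ 2) - ∑ i, (n i : ℤ) * (m i : ℤ) ^ 2) :
    ((∑ i, n i * m i : ℕ) : ℝ) / a < (k : ℝ) + 1 / k := by
  have hcountZ : ∑ i, (n i : ℤ) = (k : ℤ) ^ 2 + 3 := by exact_mod_cast hcount
  have hareaZ : ∑ i, (n i : ℤ) * (m i : ℤ) ^ 2 = (a : ℤ) ^ 2 := by exact_mod_cast harea
  rw [Finset.sum_sum_lt_weighted_sub_sq (fun i => (n i : ℤ)) (fun i => (m i : ℤ)),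
    hcountZ, hareaZ] at hdelta
  have hsqZ : ((∑ i, n i * m i : ℕ) : ℤ) ^ 2 ≤ ((k : ℤ) ^ 2 + 2) * (a : ℤ) ^ 2 := by
    push_cast
    linarith
  have hsq : ((∑ i, n i * m i : ℕ) : ℝ) ^ 2 ≤ ((k : ℝ) ^ 2 + 2) * (a : ℝ) ^ 2 := by
    exact_mod_cast hsqZ
  have hapos : (0 : ℝ) < a := by exact_mod_cast ha
  have hkpos : (0 : ℝ) < k := by exact_mod_cast (by lia : 0 < k)
  refine lt_of_pow_lt_pow_left₀ 2 (by positivity) ?_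
  calc (((∑ i, n i * m i : ℕ) : ℝ) / a) ^ 2 ≤ (k : ℝ) ^ 2 + 2 := by
        rw [div_pow, div_le_iff₀ (by positivity)]
        exact hsq
    _ < (k : ℝ) ^ 2 + 2 + (1 / k) ^ 2 := lt_add_of_pos_right _ (by positivity)
    _ = ((k : ℝ) + 1 / k) ^ 2 := by
        field_simp
        ring
end

section
/- Let n₁ ≥ 2, n₂ ≥ 1, m₂ ≥ 2, k ≥ 2, a ≥ 1 be integers with n₁ + n₂ = k² + 3 and n₁ + n₂·m₂² = a². If it is not the case that n₁ = 4 and m₂ = 2, then n₂·(n₁·(m₂−1)² − m₂²) − n₁ ≥ 0. -/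
/-- A square is congruent to `0` or `1` modulo `4`. -/
lemma sq_emod_four (x : ℤ) : x ^ 2 % 4 = 0 ∨ x ^ 2 % 4 = 1 := by
  have h : x % 4 = 0 ∨ x % 4 = 1 ∨ x % 4 = 2 ∨ x % 4 = 3 := by omega
  rcases h with h | h | h | h <;> simp [pow_two, Int.mul_emod, h]

/-- A square is congruent to `0` or `1` modulo `3`. -/
lemma sq_emod_three (x : ℤ) : x ^ 2 % 3 = 0 ∨ x ^ 2 % 3 = 1 := by
  have h : x % 3 = 0 ∨ x % 3 = 1 ∨ x % 3 = 2 := by omega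
  rcases h with h | h | h <;> simp [pow_two, Int.mul_emod, h]

/-- Nonnegativity for `n₂ = 1` implies nonnegativity for every `n₂ ≥ 1`. -/
lemma delta_nonneg_of_le {n₁ n₂ m : ℤ} (hn₁ : 0 ≤ n₁) (hn₂ : 1 ≤ n₂)
    (h : n₁ ≤ n₁ * (m - 1) ^ 2 - m ^ 2) :
    0 ≤ n₂ * (n₁ * (m - 1) ^ 2 - m ^ 2) - n₁ := by
  nlinarith [mul_nonneg (sub_nonneg.2 hn₂) (hn₁.trans h)]

theorem two_sizes_delta_nonneg (n₁ n₂ m₂ k a : ℤ)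
    (hn₁ : 2 ≤ n₁) (hn₂ : 1 ≤ n₂) (hm₂ : 2 ≤ m₂) (hk : 2 ≤ k) (ha : 1 ≤ a)
    (hcount : n₁ + n₂ = k ^ 2 + 3) (harea : n₁ + n₂ * m₂ ^ 2 = a ^ 2)
    (hne : ¬ (n₁ = 4 ∧ m₂ = 2)) :
    0 ≤ n₂ * (n₁ * (m₂ - 1) ^ 2 - m₂ ^ 2) - n₁ := by
  have hcases : m₂ = 2 ∨ m₂ = 3 ∨ 4 ≤ m₂ := by omega
  rcases hcases with rfl | rfl | hm
  · have hk4 := sq_emod_four k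
    have ha4 := sq_emod_four a
    have hk_sq : 4 ≤ k ^ 2 := by nlinarith
    have hn₁_five : 5 ≤ n₁ := by omega
    have hn₂_two : 2 ≤ n₂ := by omega
    have hdelta : 4 ≤ (n₁ - 4) * (n₂ - 1) := by
      rcases le_or_gt 8 n₁ with h | h
      · nlinarith
      · obtain rfl | hn₁_six : n₁ = 5 ∨ 6 ≤ n₁ := by omega
        · obtain rfl | hk3 : k = 2 ∨ 3 ≤ k := by omega
          · have ha_gt : 3 < a := by nlinarith
            have ha_lt : a < 4 := by nlinarith
            omega
          · nlinarith
        · obtain rfl | hn₂_three : n₂ = 2 ∨ 3 ≤ n₂ := by omega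
          · have hk3 : k < 3 := by nlinarith
            obtain rfl : k = 2 := by omega
            omega
          · nlinarith
    linarith
  · have ha3 := sq_emod_three a
    exact delta_nonneg_of_le (by omega) hn₂ (by omega)
  · refine delta_nonneg_of_le (by omega) hn₂ ?_
    nlinarith [mul_nonneg (sub_nonneg.2 hn₁)
      (mul_nonneg (by omega : 0 ≤ m₂) (by omega : 0 ≤ m₂ - 2))]
end

section
/- Let n₁ ≥ 2, n₂ ≥ 1, m₂ ≥ 2, k ≥ 2, a ≥ 1 be integers with n₁ + n₂ = k² + 3 and n₁ + n₂·m₂² = a². If it is not the case that n₁ = 4 and m₂ = 2, then (n₁ + n₂·m₂)/a < k + 1/k (as real numbers). -/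
/-- A square is not `2` or `3` modulo `4`. -/
lemma sq_emod_four_lt_two (a : ℤ) : a ^ 2 % 4 < 2 := by
  rcases Int.even_or_odd' a with ⟨b, rfl | rfl⟩ <;> ring_nf <;> omega

/-- A square is not `2` modulo `3`. -/
lemma sq_emod_three_lt_two (a : ℤ) : a ^ 2 % 3 < 2 := by
  have h : a % 3 = 0 ∨ a % 3 = 1 ∨ a % 3 = 2 := by omega
  rcases h with h | h | h <;> simp [pow_two, Int.mul_emod, h]

/-- With two tile sizes, the area is at most `x * y * (m - 1) ^ 2`, outside the exceptional case. -/
lemma area_le_mul_sq_sub_one {x y m k a : ℤ}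
    (hx : 2 ≤ x) (hy : 1 ≤ y) (hm : 2 ≤ m) (hk : 2 ≤ k)
    (hcount : x + y = k ^ 2 + 3) (harea : x + y * m ^ 2 = a ^ 2)
    (hne : ¬ (x = 4 ∧ m = 2)) :
    x + y * m ^ 2 ≤ x * y * (m - 1) ^ 2 := by
  have ha4 := sq_emod_four_lt_two a
  have hk4 := sq_emod_four_lt_two k
  obtain rfl | rfl | hm4 : m = 2 ∨ m = 3 ∨ 4 ≤ m := by omega
  · have hx4 : x ≠ 4 := fun h => hne ⟨h, rfl⟩
    have hx2 : x ≠ 2 := by omega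
    have hx3 : x ≠ 3 := by omega
    have hy1 : y ≠ 1 := by omega
    obtain rfl | hx6 : x = 5 ∨ 6 ≤ x := by omega
    · obtain rfl | hk3 : k = 2 ∨ 3 ≤ k := by omega
      · have ha13 : a ^ 2 = 13 := by omega
        have ha_lt : a < 4 := by nlinarith
        have ha_gt : -4 < a := by nlinarith
        interval_cases a <;> omega
      · nlinarith
    obtain rfl | hy3 : y = 2 ∨ 3 ≤ y := by omega
    · have : x ≠ 6 ∧ x ≠ 7 := by omega
      omega
    · nlinarith [mul_nonneg (sub_nonneg.2 hx6) (sub_nonneg.2 hy3)]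
  · have ha3 := sq_emod_three_lt_two a
    have hx3 : 3 ≤ x := by omega
    nlinarith [mul_nonneg (sub_nonneg.2 hx3) (sub_nonneg.2 hy)]
  · have hm2 : m ^ 2 + 2 ≤ 2 * (m - 1) ^ 2 := by nlinarith
    have hm1 : 1 ≤ (m - 1) ^ 2 := by nlinarith
    have hxy : 0 ≤ (x - 2) * (y * (m - 1) ^ 2 - 1) :=
      mul_nonneg (by omega) (by nlinarith)
    nlinarith [mul_le_mul_of_nonneg_left hm2 (by omega : (0 : ℤ) ≤ y)]

theorem two_sizes_sigma_lt (n₁ n₂ m₂ k a : ℤ)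
    (hn₁ : 2 ≤ n₁) (hn₂ : 1 ≤ n₂) (hm₂ : 2 ≤ m₂) (hk : 2 ≤ k) (ha : 1 ≤ a)
    (hcount : n₁ + n₂ = k ^ 2 + 3) (harea : n₁ + n₂ * m₂ ^ 2 = a ^ 2)
    (hne : ¬ (n₁ = 4 ∧ m₂ = 2)) :
    ((n₁ : ℝ) + n₂ * m₂) / a < (k : ℝ) + 1 / k := by
  have hle := area_le_mul_sq_sub_one hn₁ hn₂ hm₂ hk hcount harea hne
  have hcauchy : (n₁ + n₂ * m₂) ^ 2 = (k ^ 2 + 3) * a ^ 2 - n₁ * n₂ * (m₂ - 1) ^ 2 := by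
    rw [← hcount, ← harea]; ring
  have hsq : (k * (n₁ + n₂ * m₂)) ^ 2 < (a * (k ^ 2 + 1)) ^ 2 := by
    rw [mul_pow, hcauchy]
    rw [harea] at hle
    nlinarith [mul_le_mul_of_nonneg_left hle (sq_nonneg k), pow_pos (by omega : 0 < a) 2]
  have hlt : k * (n₁ + n₂ * m₂) < a * (k ^ 2 + 1) :=
    lt_of_pow_lt_pow_left₀ 2 (by positivity) hsq
  have ha0 : (0 : ℝ) < a := by exact_mod_cast (by omega : 0 < a)
  have hk0 : (0 : ℝ) < k := by exact_mod_cast (by omega : 0 < k)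
  have hlt' : (k : ℝ) * (n₁ + n₂ * m₂) < a * (k ^ 2 + 1) := by exact_mod_cast hlt
  have hsum : (k : ℝ) + 1 / k = (k ^ 2 + 1) / k := by field_simp
  rw [hsum, div_lt_div_iff₀ ha0 hk0]
  linarith
end

section
/- Let n₁ ≥ 2, n₂ ≥ 1, n₃ ≥ 1 and 2 ≤ m₂ < m₃ be integers, and suppose there exist integers k ≥ 2 and a ≥ 1 with n₁ + n₂ + n₃ = k² + 3 and n₁ + n₂·m₂² + n₃·m₃² = a². Then n₁·n₂·(m₂−1)² + n₁·n₃·(m₃−1)² + n₂·n₃·(m₃−m₂)² ≥ n₁ + n₂·m₂² + n₃·m₃². -/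
/-- If the sizes and multiplicities are not the extremal ones `n₁ = 2`, `m₂ = 2`, `m₃ = 3`, the
inequality holds without any condition that the count or the area come from squares. -/
theorem delta_nonneg_of_not_extremal {n₁ n₂ n₃ m₂ m₃ : ℤ}
    (hn₁ : 2 ≤ n₁) (hn₂ : 1 ≤ n₂) (hn₃ : 1 ≤ n₃) (hm₂ : 2 ≤ m₂) (hm : m₂ < m₃)
    (h : 3 ≤ n₁ ∨ 3 ≤ m₂ ∨ 4 ≤ m₃) :
    n₁ + n₂ * m₂ ^ 2 + n₃ * m₃ ^ 2 ≤
      n₁ * n₂ * (m₂ - 1) ^ 2 + n₁ * n₃ * (m₃ - 1) ^ 2 + n₂ * n₃ * (m₃ - m₂) ^ 2 := by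
  obtain ⟨q, rfl⟩ : ∃ q, n₂ = q + 1 := ⟨n₂ - 1, by ring⟩
  obtain ⟨r, rfl⟩ : ∃ r, n₃ = r + 1 := ⟨n₃ - 1, by ring⟩
  obtain ⟨u, rfl⟩ : ∃ u, m₂ = u + 2 := ⟨m₂ - 2, by ring⟩
  obtain ⟨v, rfl⟩ : ∃ v, m₃ = u + v + 3 := ⟨m₃ - u - 3, by ring⟩
  have hq : 0 ≤ q := by linarith
  have hr : 0 ≤ r := by linarith
  have hu : 0 ≤ u := by linarith
  have hv : 0 ≤ v := by linarith
  rw [← sub_nonneg]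
  by_cases hp : 3 ≤ n₁
  · obtain ⟨p, rfl⟩ : ∃ p, n₁ = p + 3 := ⟨n₁ - 3, by ring⟩
    have hp : 0 ≤ p := by linarith
    ring_nf
    positivity
  obtain rfl : n₁ = 2 := by linarith
  by_cases hu' : 1 ≤ u
  · obtain ⟨t, rfl⟩ : ∃ t, u = t + 1 := ⟨u - 1, by ring⟩
    have ht : 0 ≤ t := by linarith
    ring_nf
    positivity
  obtain rfl : u = 0 := by linarith
  obtain ⟨t, rfl⟩ : ∃ t, v = t + 1 := ⟨v - 1, by ring⟩
  have ht : 0 ≤ t := by omega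
  ring_nf
  positivity

/-- In the extremal case `n₁ = 2`, `m₂ = 2`, `m₃ = 3` the square conditions on the count and the
area exclude all multiplicities violating the inequality. -/
theorem delta_nonneg_extremal {n₂ n₃ k a : ℤ} (hn₂ : 1 ≤ n₂) (hn₃ : 1 ≤ n₃) (hk : 2 ≤ k)
    (hcount : 2 + n₂ + n₃ = k ^ 2 + 3) (harea : 2 + n₂ * 4 + n₃ * 9 = a ^ 2) :
    4 ≤ (n₂ - 1) * (n₃ - 2) := by
  by_contra! hlt
  obtain rfl | rfl | hn₃' : n₃ = 1 ∨ n₃ = 2 ∨ 3 ≤ n₃ := by omega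
  · obtain ⟨b, rfl | rfl⟩ := a.even_or_odd' <;> ring_nf at harea <;> omega
  · obtain ⟨b, rfl | rfl⟩ := a.even_or_odd'
    · have hb : b ^ 2 = k ^ 2 + 4 := by linarith
      have hlo : k < |b| := lt_of_pow_lt_pow_left₀ 2 (abs_nonneg b) (by rw [sq_abs]; linarith)
      have hhi : |b| < k + 1 := lt_of_pow_lt_pow_left₀ 2 (by linarith) (by
        rw [sq_abs]; nlinarith)
      omega
    · ring_nf at harea; omega
  obtain rfl | hn₂' : n₂ = 1 ∨ 2 ≤ n₂ := by omega
  · obtain ⟨b, hb⟩ : (3 : ℤ) ∣ a :=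
      Int.prime_three.dvd_of_dvd_pow (n := 2) (by omega)
    subst hb
    ring_nf at harea
    omega
  have hn₂_le : n₂ ≤ 4 := by nlinarith
  have hn₃_le : n₃ ≤ 5 := by nlinarith
  obtain rfl : k = 2 := by nlinarith
  obtain rfl : n₃ = 5 - n₂ := by linarith
  obtain rfl : n₂ = 2 := by omega
  have hlo : 6 < |a| := lt_of_pow_lt_pow_left₀ 2 (abs_nonneg a) (by rw [sq_abs]; linarith)
  have hhi : |a| < 7 := lt_of_pow_lt_pow_left₀ 2 (by norm_num) (by rw [sq_abs]; linarith)
  omega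

theorem three_sizes_delta_nonneg (n₁ n₂ n₃ m₂ m₃ : ℤ)
    (hn₁ : 2 ≤ n₁) (hn₂ : 1 ≤ n₂) (hn₃ : 1 ≤ n₃)
    (hm₂ : 2 ≤ m₂) (hm : m₂ < m₃)
    (h : ∃ k a : ℤ, 2 ≤ k ∧ 1 ≤ a ∧ n₁ + n₂ + n₃ = k ^ 2 + 3 ∧
      n₁ + n₂ * m₂ ^ 2 + n₃ * m₃ ^ 2 = a ^ 2) :
    n₁ + n₂ * m₂ ^ 2 + n₃ * m₃ ^ 2 ≤
      n₁ * n₂ * (m₂ - 1) ^ 2 + n₁ * n₃ * (m₃ - 1) ^ 2 + n₂ * n₃ * (m₃ - m₂) ^ 2 := by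
  by_cases hne : 3 ≤ n₁ ∨ 3 ≤ m₂ ∨ 4 ≤ m₃
  · exact delta_nonneg_of_not_extremal hn₁ hn₂ hn₃ hm₂ hm hne
  obtain rfl : n₁ = 2 := by omega
  obtain rfl : m₂ = 2 := by omega
  obtain rfl : m₃ = 3 := by omega
  obtain ⟨k, a, hk, -, hcount, harea⟩ := h
  linarith [delta_nonneg_extremal hn₂ hn₃ hk hcount (by linarith)]
end

section
/- Let n₁ ≥ 2, n₂ ≥ 1, n₃ ≥ 1, n₄ ≥ 1 and 2 ≤ m₂ < m₃ < m₄ be integers. Then n₁·n₂·(m₂−1)² + n₁·n₃·(m₃−1)² + n₁·n₄·(m₄−1)² + n₂·n₃·(m₃−m₂)² + n₂·n₄·(m₄−m₂)² + n₃·n₄·(m₄−m₃)² ≥ n₁ + n₂·m₂² + n₃·m₃² + n₄·m₄². -/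
theorem four_sizes_delta_nonneg (n₁ n₂ n₃ n₄ m₂ m₃ m₄ : ℤ)
    (hn₁ : 2 ≤ n₁) (hn₂ : 1 ≤ n₂) (hn₃ : 1 ≤ n₃) (hn₄ : 1 ≤ n₄)
    (hm₂ : 2 ≤ m₂) (hm₂₃ : m₂ < m₃) (hm₃₄ : m₃ < m₄) :
    n₁ + n₂ * m₂ ^ 2 + n₃ * m₃ ^ 2 + n₄ * m₄ ^ 2 ≤
      n₁ * n₂ * (m₂ - 1) ^ 2 + n₁ * n₃ * (m₃ - 1) ^ 2 + n₁ * n₄ * (m₄ - 1) ^ 2 +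
        n₂ * n₃ * (m₃ - m₂) ^ 2 + n₂ * n₄ * (m₄ - m₂) ^ 2 + n₃ * n₄ * (m₄ - m₃) ^ 2 := by
  obtain ⟨a, rfl⟩ := Int.le.dest hn₁
  obtain ⟨b, rfl⟩ := Int.le.dest hn₂
  obtain ⟨c, rfl⟩ := Int.le.dest hn₃
  obtain ⟨d, rfl⟩ := Int.le.dest hn₄
  obtain ⟨x, rfl⟩ := Int.le.dest hm₂
  obtain ⟨y, rfl⟩ := Int.le.dest (Int.add_one_le_of_lt hm₂₃)
  obtain ⟨z, rfl⟩ := Int.le.dest (Int.add_one_le_of_lt hm₃₄)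
  -- In the slack variables the difference of the two sides has only nonnegative coefficients.
  rw [← sub_nonneg]
  ring_nf
  positivity
end

section
/- Let r ≥ 4 be a natural number, let n : Fin r → ℕ satisfy n_0 ≥ 2 and n_i ≥ 1 for all i, and let m : Fin r → ℕ be strictly increasing with m_0 = 1. Then ∑_{i<j} n_i·n_j·(m_j − m_i)² ≥ ∑_i n_i·m_i². -/
lemma sq_le_mul_sub_one_sq {a w : ℤ} (ha : 2 ≤ a) (hw : 4 ≤ w) :
    w ^ 2 ≤ a * (w - 1) ^ 2 :=
  calc w ^ 2 ≤ 2 * (w - 1) ^ 2 := by nlinarith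
    _ ≤ a * (w - 1) ^ 2 := by gcongr

/-- The contribution of the four smallest sizes `1 < x < y < z` to `δ` is nonnegative. -/
lemma four_sizes_delta_nonneg_s16 {a b c d x y z : ℤ} (ha : 2 ≤ a) (hb : 1 ≤ b) (hc : 1 ≤ c)
    (hd : 1 ≤ d) (hx : 2 ≤ x) (hxy : x + 1 ≤ y) (hyz : y + 1 ≤ z) :
    a + b * x ^ 2 + c * y ^ 2 + d * z ^ 2 ≤
      a * b * (x - 1) ^ 2 + a * c * (y - 1) ^ 2 + a * d * (z - 1) ^ 2 +
        b * c * (y - x) ^ 2 + b * d * (z - x) ^ 2 + c * d * (z - y) ^ 2 := by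
  have hbx : 1 ≤ b * (x - 1) ^ 2 := one_le_mul_of_one_le_of_one_le hb (by nlinarith)
  have hcy : 0 ≤ c * (y - 1) ^ 2 := by positivity
  have hdz : 0 ≤ d * (z - 1) ^ 2 := by positivity
  have reduce_a := mul_nonneg (sub_nonneg.2 ha)
    (by linarith : 0 ≤ b * (x - 1) ^ 2 + c * (y - 1) ^ 2 + d * (z - 1) ^ 2 - 1)
  have fx : b * (-2) ≤ b * ((x - 2) ^ 2 - 2) := by gcongr; nlinarith
  have fy : c * (-1) ≤ c * ((y - 2) ^ 2 - 2) := by gcongr; nlinarith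
  have fz : d * 2 ≤ d * ((z - 2) ^ 2 - 2) := by gcongr; nlinarith
  have gxy : b * c * 1 ≤ b * c * (y - x) ^ 2 := by gcongr; nlinarith
  have gxz : b * d * 4 ≤ b * d * (z - x) ^ 2 := by gcongr; nlinarith
  have gyz : c * d * 1 ≤ c * d * (z - y) ^ 2 := by gcongr; nlinarith
  have hbd := mul_nonneg (by linarith : 0 ≤ b) (sub_nonneg.2 hd)
  have hcd := mul_nonneg (by linarith : 0 ≤ c) (sub_nonneg.2 hd)
  have hbc : 0 ≤ b * c := by positivity
  linarith

theorem many_sizes_delta_nonneg (r : ℕ) (hr : 4 ≤ r)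
    (n : Fin r → ℕ) (hn0 : 2 ≤ n ⟨0, by omega⟩) (hn : ∀ i, 1 ≤ n i)
    (m : Fin r → ℕ) (hm : StrictMono m) (hm0 : m ⟨0, by omega⟩ = 1) :
    (∑ i, (n i : ℤ) * (m i : ℤ) ^ 2) ≤
      ∑ i, ∑ j ∈ Finset.univ.filter (fun j => i < j),
        (n i : ℤ) * n j * ((m j : ℤ) - m i) ^ 2 := by
  obtain ⟨s, rfl⟩ := Nat.exists_eq_add_of_le' hr
  have h01 : m 0 < m (Fin.succ 0) := hm (by simp only [Fin.succ_pos])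
  have h12 : m (Fin.succ 0) < m (Fin.succ (Fin.succ 0)) :=
    hm (by simp only [Fin.succ_lt_succ_iff, Fin.succ_pos])
  have h23 : m (Fin.succ (Fin.succ 0)) < m (Fin.succ (Fin.succ (Fin.succ 0))) :=
    hm (by simp only [Fin.succ_lt_succ_iff, Fin.succ_pos])
  have h34 (k : Fin s) :
      m (Fin.succ (Fin.succ (Fin.succ 0))) < m k.succ.succ.succ.succ :=
    hm (by simp only [Fin.succ_lt_succ_iff, Fin.succ_pos])
  change 2 ≤ n 0 at hn0
  change m 0 = 1 at hm0
  have four := four_sizes_delta_nonneg_s16 (a := n 0) (b := n (Fin.succ 0))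
    (c := n (Fin.succ (Fin.succ 0))) (d := n (Fin.succ (Fin.succ (Fin.succ 0))))
    (x := m (Fin.succ 0)) (y := m (Fin.succ (Fin.succ 0)))
    (z := m (Fin.succ (Fin.succ (Fin.succ 0))))
    (by exact_mod_cast hn0) (by exact_mod_cast hn _) (by exact_mod_cast hn _)
    (by exact_mod_cast hn _) (by omega) (by omega) (by omega)
  have tail : ∑ k : Fin s, (n k.succ.succ.succ.succ : ℤ) * (m k.succ.succ.succ.succ : ℤ) ^ 2 ≤
      ∑ k : Fin s, (n 0 : ℤ) * n k.succ.succ.succ.succ *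
        ((m k.succ.succ.succ.succ : ℤ) - 1) ^ 2 := by
    refine Finset.sum_le_sum fun k _ => ?_
    have hk := h34 k
    have hmk : (4 : ℤ) ≤ m k.succ.succ.succ.succ := by omega
    have ha : (2 : ℤ) ≤ n 0 := by exact_mod_cast hn0
    have hsq := sq_le_mul_sub_one_sq ha hmk
    calc _ ≤ (n k.succ.succ.succ.succ : ℤ) *
          (n 0 * ((m k.succ.succ.succ.succ : ℤ) - 1) ^ 2) := by gcongr
      _ = _ := by ring
  have row_nonneg (i : Fin (s + 4)) (f : Fin s → Fin (s + 4)) :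
      0 ≤ ∑ k, (n i : ℤ) * n (f k) * ((m (f k) : ℤ) - m i) ^ 2 := by positivity
  have rest_nonneg : 0 ≤ ∑ i : Fin s, ∑ j : Fin s, if i < j then
      (n i.succ.succ.succ.succ : ℤ) * n j.succ.succ.succ.succ *
        ((m j.succ.succ.succ.succ : ℤ) - m i.succ.succ.succ.succ) ^ 2 else 0 :=
    Finset.sum_nonneg fun i _ => Finset.sum_nonneg fun j _ => by split_ifs <;> positivity
  have row₁ := row_nonneg (Fin.succ 0) fun k => k.succ.succ.succ.succ
  have row₂ := row_nonneg (Fin.succ (Fin.succ 0)) fun k => k.succ.succ.succ.succ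
  have row₃ := row_nonneg (Fin.succ (Fin.succ (Fin.succ 0))) fun k => k.succ.succ.succ.succ
  simp only [Finset.sum_filter, Fin.sum_univ_succ, Fin.succ_lt_succ_iff, Fin.succ_pos,
    Fin.not_lt_zero, if_true, if_false, zero_add, one_pow, mul_one, hm0, Nat.cast_one]
  linarith
end

section
/- Let k ≥ 2, a ≥ 1, r ≥ 1 be integers, let n : Fin r → ℕ satisfy n_i ≥ 1 for all i, and let m : Fin r → ℕ be strictly increasing with m_0 = 1. Assume ∑_i n_i = k² + 3 and ∑_i n_i·m_i² = a². If (∑_i n_i·m_i)/a > k + 1/k (as real numbers), then n_0 = 1. -/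
/-- The weighted sum of a quadratic polynomial `(m - p) * (m - q)` that is nonnegative at all `m i`
is at least its term at any single index. -/
theorem le_sum_weighted_quadratic {ι : Type*} [Fintype ι] (n m : ι → ℤ) (p q : ℤ) (j : ι)
    (hn : ∀ i, 0 ≤ n i) (hpq : ∀ x : ℤ, 0 ≤ (x - p) * (x - q)) :
    n j * ((m j - p) * (m j - q)) ≤
      ∑ i, n i * m i ^ 2 - (p + q) * ∑ i, n i * m i + p * q * ∑ i, n i := by
  have key : ∑ i, n i * m i ^ 2 - (p + q) * ∑ i, n i * m i + p * q * ∑ i, n i =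
      ∑ i, n i * ((m i - p) * (m i - q)) := by
    simp only [Finset.mul_sum, ← Finset.sum_sub_distrib, ← Finset.sum_add_distrib]
    exact Finset.sum_congr rfl fun i _ => by ring
  rw [key]
  exact Finset.single_le_sum (f := fun i => n i * ((m i - p) * (m i - q)))
    (fun i _ => mul_nonneg (hn i) (hpq _)) (Finset.mem_univ j)

/-- With `a = k * c + e` the division of `a` by `k`, a total side length `S / a > k + 1 / k` is
incompatible with the two quadratic bounds that two tiles of size `1` impose. -/
theorem false_of_quadratic_bounds (k c e S : ℤ) (hk : 2 ≤ k) (he : 0 ≤ e) (hek : e < k)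
    (hc : 0 ≤ c) (hS : (k * c + e) * (k ^ 2 + 1) < k * S)
    (hmid : 2 * (c * (c - 1)) ≤
      (k * c + e) ^ 2 - (2 * c + 1) * S + c * (c + 1) * (k ^ 2 + 3))
    (hsq : 2 * (c - 1) ^ 2 ≤ (k * c + e) ^ 2 - 2 * c * S + c ^ 2 * (k ^ 2 + 3)) : False := by
  have key : k * (e * (k - e)) + (2 * c + 1) * (e + 1) ≤ k * (c * (4 - c)) := by
    have h1 := mul_le_mul_of_nonneg_left hmid (by omega : (0 : ℤ) ≤ k)
    have h2 := mul_le_mul_of_nonneg_left (Int.add_one_le_iff.mpr hS)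
      (by omega : (0 : ℤ) ≤ 2 * c + 1)
    linarith
  have hpos : 0 < c * (4 - c) := by
    have h1 : 0 ≤ k * (e * (k - e)) :=
      mul_nonneg (by omega) (mul_nonneg he (by omega))
    have h2 : 0 < (2 * c + 1) * (e + 1) := mul_pos (by omega) (by omega)
    exact pos_of_mul_pos_right (by linarith : 0 < k * (c * (4 - c))) (by omega)
  have hc4 : 0 < 4 - c := pos_of_mul_pos_right hpos hc
  rcases he.eq_or_lt with rfl | he
  · have h1 : c * (k ^ 2 + 1) < S := by
      refine lt_of_mul_lt_mul_left ?_ (by omega : (0 : ℤ) ≤ k)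
      linarith
    have hc4 : c < 4 := by omega
    interval_cases c <;> linarith
  · have h1 : k - 1 ≤ e * (k - e) := by nlinarith
    have h2 : k * (k - 1) < k * 4 := by
      have h3 : k * (k - 1) ≤ k * (e * (k - e)) := mul_le_mul_of_nonneg_left h1 (by omega)
      have h4 : c * (4 - c) ≤ 4 := by nlinarith [sq_nonneg (c - 2)]
      have h5 : k * (c * (4 - c)) ≤ k * 4 := mul_le_mul_of_nonneg_left h4 (by omega)
      have h6 : 0 < (2 * c + 1) * (e + 1) := mul_pos (by omega) (by omega)
      linarith
    have hk5 : k - 1 < 4 := lt_of_mul_lt_mul_left h2 (by omega)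
    have hk5 : k < 5 := by omega
    have hc4 : c < 4 := by omega
    interval_cases k <;> interval_cases c <;> interval_cases e <;> omega

theorem main_theorem_unique_smallest (k a r : ℕ) (hk : 2 ≤ k) (ha : 1 ≤ a) (hr : 1 ≤ r)
    (n : Fin r → ℕ) (hn : ∀ i, 1 ≤ n i)
    (m : Fin r → ℕ) (hm : StrictMono m) (hm0 : m ⟨0, by omega⟩ = 1)
    (hcount : ∑ i, n i = k ^ 2 + 3)
    (harea : ∑ i, n i * m i ^ 2 = a ^ 2)
    (hsigma : (k : ℝ) + 1 / k < ((∑ i, n i * m i : ℕ) : ℝ) / a) :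
    n ⟨0, by omega⟩ = 1 := by
  by_contra hne
  have hn0 : (2 : ℤ) ≤ n ⟨0, by omega⟩ := by
    have := hn ⟨0, by omega⟩
    omega
  have hS : (a : ℤ) * (k ^ 2 + 1) < k * ∑ i, (n i : ℤ) * m i := by
    have hk0 : (0 : ℝ) < k := by positivity
    have ha0 : (0 : ℝ) < a := by positivity
    rw [lt_div_iff₀ ha0] at hsigma
    have h := mul_lt_mul_of_pos_left hsigma hk0
    have h' : (k : ℝ) * ((k + 1 / k) * a) = a * (k ^ 2 + 1) := by
      field_simp
    rw [h'] at h
    exact_mod_cast h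
  have hcount' : ∑ i, (n i : ℤ) = k ^ 2 + 3 := by exact_mod_cast hcount
  have harea' : ∑ i, (n i : ℤ) * (m i : ℤ) ^ 2 = a ^ 2 := by exact_mod_cast harea
  have hdiv : (k : ℤ) * (a / k : ℕ) + (a % k : ℕ) = a := by exact_mod_cast Nat.div_add_mod a k
  have hmod : ((a % k : ℕ) : ℤ) < k := by exact_mod_cast Nat.mod_lt a (by omega)
  generalize a / k = c at hdiv
  have hmid := le_sum_weighted_quadratic (fun i => (n i : ℤ)) (fun i => (m i : ℤ)) c (c + 1)
    ⟨0, by omega⟩ (fun i => by positivity) fun x => by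
      rcases le_or_gt x c with h | h
      · exact mul_nonneg_of_nonpos_of_nonpos (by omega) (by omega)
      · exact mul_nonneg (by omega) (by omega)
  have hsq := le_sum_weighted_quadratic (fun i => (n i : ℤ)) (fun i => (m i : ℤ)) c c
    ⟨0, by omega⟩ (fun i => by positivity) fun x => mul_self_nonneg _
  simp only [hcount', harea', hm0, Nat.cast_one] at hmid hsq
  have hcc : (0 : ℤ) ≤ (c : ℤ) * (c - 1) := by
    rcases Nat.eq_zero_or_pos c with rfl | h
    · simp
    · exact mul_nonneg (by omega) (by omega)
  refine false_of_quadratic_bounds k c (a % k : ℕ) (∑ i, (n i : ℤ) * m i) (by omega)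
    (by positivity) hmod (by positivity) (hdiv ▸ hS) ?_ ?_
  · rw [hdiv]
    linarith [mul_le_mul_of_nonneg_right hn0 hcc]
  · rw [hdiv]
    linarith [mul_le_mul_of_nonneg_right hn0 (sq_nonneg ((c : ℤ) - 1))]
end
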